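/- arXiv:2111.00780 — 7 statements merged into one kernel-verified Lean document; each statement's English description precedes it below -/
import Mathlib

section
/- Let p and q be probability densities with respect to μ such that ∫ p^{γ+1} dμ and ∫ q^{γ+1} dμ are finite and positive. Then the expected pseudo-spherical score satisfies S_ps(p, q) = (∫ p q^γ dμ) / (∫ q^{γ+1} dμ)^{γ/(γ+1)} ≤ (∫ p^{γ+1} dμ)^{1/(γ+1)} = S_ps(p, p), with equality if and only if p = q μ-almost everywhere. In other words, the pseudo-spherical scoring rule is strictly proper. -/
open MeasureTheory

/-- The pseudo-spherical scoring rule is strictly proper: for probability densities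
`p`, `q` (w.r.t. `μ`) with finite positive `(γ+1)`-th power integrals, the expected
pseudo-spherical score satisfies
`S_ps(p, q) = (∫ p q^γ) / (∫ q^{γ+1})^{γ/(γ+1)} ≤ (∫ p^{γ+1})^{1/(γ+1)} = S_ps(p, p)`,
with equality iff `p = q` μ-a.e. -/
theorem pseudo_spherical_strictly_proper
    {X : Type*} [MeasurableSpace X] (μ : Measure X) [SigmaFinite μ]
    (γ : ℝ) (hγ : 0 < γ)
    (p q : X → ℝ) (hp : Measurable p) (hq : Measurable q)
    (hp0 : ∀ x, 0 ≤ p x) (hq0 : ∀ x, 0 ≤ q x)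
    (hp1 : ∫ x, p x ∂μ = 1) (hq1 : ∫ x, q x ∂μ = 1)
    (hpPow : Integrable (fun x => p x ^ (γ + 1)) μ)
    (hpPos : 0 < ∫ x, p x ^ (γ + 1) ∂μ)
    (hqPow : Integrable (fun x => q x ^ (γ + 1)) μ)
    (hqPos : 0 < ∫ x, q x ^ (γ + 1) ∂μ) :
    (∫ x, p x * q x ^ γ ∂μ) / (∫ x, q x ^ (γ + 1) ∂μ) ^ (γ / (γ + 1))
        ≤ (∫ x, p x ^ (γ + 1) ∂μ) ^ (1 / (γ + 1))
    ∧ ((∫ x, p x * q x ^ γ ∂μ) / (∫ x, q x ^ (γ + 1) ∂μ) ^ (γ / (γ + 1))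
        = (∫ x, p x ^ (γ + 1) ∂μ) ^ (1 / (γ + 1)) ↔ p =ᵐ[μ] q) := by
  set P := ∫ x, p x ^ (γ + 1) ∂μ with hP
  set Q := ∫ x, q x ^ (γ + 1) ∂μ with hQ
  have hs : 0 < γ + 1 := by linarith
  have hpq : (γ + 1).HolderConjugate ((γ + 1) / γ) := by
    rw [Real.holderConjugate_iff]
    refine ⟨by linarith, ?_⟩
    field_simp
    ring
  set A := P ^ (1 / (γ + 1)) with hA
  set B := Q ^ (1 / (γ + 1)) with hB
  have hA0 : 0 < A := Real.rpow_pos_of_pos hpPos _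
  have hB0 : 0 < B := Real.rpow_pos_of_pos hqPos _
  have hAs : A ^ (γ + 1) = P := by
    rw [hA, ← Real.rpow_mul hpPos.le, one_div_mul_cancel hs.ne', Real.rpow_one]
  have hBs : B ^ (γ + 1) = Q := by
    rw [hB, ← Real.rpow_mul hqPos.le, one_div_mul_cancel hs.ne', Real.rpow_one]
  have hBg : Q ^ (γ / (γ + 1)) = B ^ γ := by
    rw [hB, ← Real.rpow_mul hqPos.le]
    congr 1
    ring
  have hBg0 : 0 < B ^ γ := Real.rpow_pos_of_pos hB0 _
  rw [hBg]
  have ha0 : ∀ x, 0 ≤ p x / A := fun x => div_nonneg (hp0 x) hA0.le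
  have hc0 : ∀ x, 0 ≤ q x / B := fun x => div_nonneg (hq0 x) hB0.le
  have hb0 : ∀ x, 0 ≤ (q x / B) ^ γ := fun x => Real.rpow_nonneg (hc0 x) _
  have has : ∀ x, (p x / A) ^ (γ + 1) = p x ^ (γ + 1) / P := fun x => by
    rw [Real.div_rpow (hp0 x) hA0.le, hAs]
  have hbt' : ∀ x, ((q x / B) ^ γ) ^ ((γ + 1) / γ) = (q x / B) ^ (γ + 1) := fun x => by
    rw [← Real.rpow_mul (hc0 x), mul_div_cancel₀ _ hγ.ne']
  have hbt : ∀ x, ((q x / B) ^ γ) ^ ((γ + 1) / γ) = q x ^ (γ + 1) / Q := fun x => by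
    rw [hbt', Real.div_rpow (hq0 x) hB0.le, hBs]
  have hab : ∀ x, p x / A * (q x / B) ^ γ = p x * q x ^ γ / (A * B ^ γ) := fun x => by
    rw [Real.div_rpow (hq0 x) hB0.le, div_mul_div_comm]
  have hY : ∀ x, p x * q x ^ γ / (A * B ^ γ) ≤
      p x ^ (γ + 1) / P / (γ + 1) + q x ^ (γ + 1) / Q / ((γ + 1) / γ) := fun x => by
    rw [← hab, ← has, ← hbt]
    exact Real.young_inequality_of_nonneg (ha0 x) (hb0 x) hpq
  have hYe : ∀ x, p x * q x ^ γ / (A * B ^ γ) =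
      p x ^ (γ + 1) / P / (γ + 1) + q x ^ (γ + 1) / Q / ((γ + 1) / γ) ↔
      p x / A = q x / B := fun x => by
    rw [← hab, ← has, ← hbt, Real.young_inequality_eq_iff_of_nonneg (ha0 x) (hb0 x) hpq, hbt',
      Real.rpow_left_inj (ha0 x) (hc0 x) hs.ne']
  have i1 : Integrable (fun x => p x ^ (γ + 1) / P / (γ + 1)) μ :=
    (hpPow.div_const _).div_const _
  have i2 : Integrable (fun x => q x ^ (γ + 1) / Q / ((γ + 1) / γ)) μ :=
    (hqPow.div_const _).div_const _
  have iR : Integrable (fun x => p x ^ (γ + 1) / P / (γ + 1) +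
      q x ^ (γ + 1) / Q / ((γ + 1) / γ)) μ := i1.add i2
  have iL : Integrable (fun x => p x * q x ^ γ / (A * B ^ γ)) μ := by
    refine iR.mono' (by fun_prop) (Filter.Eventually.of_forall fun x => ?_)
    rw [Real.norm_of_nonneg]
    · exact hY x
    · exact div_nonneg (mul_nonneg (hp0 x) (Real.rpow_nonneg (hq0 x) _)) (by positivity)
  have eR : ∫ x, (p x ^ (γ + 1) / P / (γ + 1) + q x ^ (γ + 1) / Q / ((γ + 1) / γ)) ∂μ = 1 := by
    rw [integral_add i1 i2, integral_div, integral_div, integral_div, integral_div, ← hP, ← hQ,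
      div_self hpPos.ne', div_self hqPos.ne']
    field_simp
    ring
  have eL : ∫ x, p x * q x ^ γ / (A * B ^ γ) ∂μ = (∫ x, p x * q x ^ γ ∂μ) / (A * B ^ γ) :=
    integral_div _ _
  have hle := integral_mono iL iR hY
  rw [eL, eR, div_le_one (by positivity)] at hle
  refine ⟨by rwa [div_le_iff₀ hBg0], ?_⟩
  have key : (∫ x, p x * q x ^ γ ∂μ) / B ^ γ = A ↔ ∀ᵐ x ∂μ, p x / A = q x / B := by
    have h := integral_eq_iff_of_ae_le iL iR (Filter.Eventually.of_forall hY)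
    rw [eL, eR, div_eq_one_iff_eq (by positivity)] at h
    rw [div_eq_iff hBg0.ne', h]
    exact Filter.eventually_congr (Filter.Eventually.of_forall hYe)
  rw [key]
  constructor
  · intro h
    have h1 := integral_congr_ae h
    rw [integral_div, integral_div, hp1, hq1] at h1
    have hAB : A = B := by
      field_simp at h1
      exact h1.symm
    filter_upwards [h] with x hx
    rw [hAB] at hx
    exact (div_left_inj' hB0.ne').1 hx
  · intro h
    have hPQ : P = Q := integral_congr_ae (by filter_upwards [h] with x hx; rw [hx])
    have hAB : A = B := by rw [hA, hB, hPQ]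
    filter_upwards [h] with x hx
    rw [hx, hAB]
end

section
/- Let p and q be probability densities with respect to μ such that ∫ p^{γ+1} dμ and ∫ q^{γ+1} dμ are finite and positive and ∫ p q^γ dμ is finite and positive. Then the γ-divergence D_γ(p, q) = −(1/γ)·log(∫ p q^γ dμ) + (1/(γ+1))·log(∫ q^{γ+1} dμ) + (1/(γ(γ+1)))·log(∫ p^{γ+1} dμ) is nonnegative, and D_γ(p, q) = 0 if and only if p = q μ-almost everywhere. In other words, the γ-score S_γ(p,q) = (1/γ)·log(∫ p q^γ dμ) − (1/(γ+1))·log(∫ q^{γ+1} dμ) is a strictly proper composite scoring rule. -/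
open MeasureTheory

/-- The γ-divergence associated with the γ-score is nonnegative and vanishes
exactly when `p = q` μ-a.e.; i.e. the γ-score is a strictly proper composite
scoring rule. -/
theorem gamma_divergence_nonneg_and_zero_iff
    {X : Type*} [MeasurableSpace X] (μ : Measure X) [SigmaFinite μ]
    (γ : ℝ) (hγ : 0 < γ)
    (p q : X → ℝ) (hp : Measurable p) (hq : Measurable q)
    (hp0 : ∀ x, 0 ≤ p x) (hq0 : ∀ x, 0 ≤ q x)
    (hp1 : ∫ x, p x ∂μ = 1) (hq1 : ∫ x, q x ∂μ = 1)
    (hpPow : Integrable (fun x => p x ^ (γ + 1)) μ)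
    (hpPos : 0 < ∫ x, p x ^ (γ + 1) ∂μ)
    (hqPow : Integrable (fun x => q x ^ (γ + 1)) μ)
    (hqPos : 0 < ∫ x, q x ^ (γ + 1) ∂μ)
    (hpq : Integrable (fun x => p x * q x ^ γ) μ)
    (hpqPos : 0 < ∫ x, p x * q x ^ γ ∂μ) :
    0 ≤ -(1 / γ) * Real.log (∫ x, p x * q x ^ γ ∂μ)
        + (1 / (γ + 1)) * Real.log (∫ x, q x ^ (γ + 1) ∂μ)
        + (1 / (γ * (γ + 1))) * Real.log (∫ x, p x ^ (γ + 1) ∂μ)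
    ∧ (-(1 / γ) * Real.log (∫ x, p x * q x ^ γ ∂μ)
        + (1 / (γ + 1)) * Real.log (∫ x, q x ^ (γ + 1) ∂μ)
        + (1 / (γ * (γ + 1))) * Real.log (∫ x, p x ^ (γ + 1) ∂μ) = 0
        ↔ p =ᵐ[μ] q) := by
  have hs : 0 < γ + 1 := by linarith
  have hconj : (γ + 1).HolderConjugate ((γ + 1) / γ) := by
    rw [Real.holderConjugate_iff]
    refine ⟨by linarith, ?_⟩
    field_simp
    ring
  -- pointwise Young inequality and its equality case
  have young : ∀ a b : ℝ, 0 ≤ a → 0 ≤ b →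
      a * b ^ γ ≤ a ^ (γ + 1) / (γ + 1) + b ^ (γ + 1) * γ / (γ + 1) ∧
      (a * b ^ γ = a ^ (γ + 1) / (γ + 1) + b ^ (γ + 1) * γ / (γ + 1) → a = b) := by
    intro a b ha hb
    have hbp : (b ^ γ) ^ ((γ + 1) / γ) = b ^ (γ + 1) := by
      rw [← Real.rpow_mul hb]
      congr 1
      field_simp
    have h1 := Real.young_inequality_of_nonneg ha (Real.rpow_nonneg hb γ) hconj
    have h2 := Real.young_inequality_eq_iff_of_nonneg ha (Real.rpow_nonneg hb γ) hconj
    have e : b ^ (γ + 1) / ((γ + 1) / γ) = b ^ (γ + 1) * γ / (γ + 1) := by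
      field_simp
    rw [hbp, e] at h1 h2
    refine ⟨h1, fun h => ?_⟩
    exact (Real.rpow_left_inj ha hb hs.ne').1 (h2.1 h)
  set P := ∫ x, p x ^ (γ + 1) ∂μ with hP
  set Q := ∫ x, q x ^ (γ + 1) ∂μ with hQ
  set I := ∫ x, p x * q x ^ γ ∂μ with hI
  obtain ⟨c, hc, hclog⟩ : ∃ c : ℝ, 0 < c ∧ Real.log c = (Real.log P - Real.log Q) / (γ + 1) :=
    ⟨Real.exp ((Real.log P - Real.log Q) / (γ + 1)), Real.exp_pos _, Real.log_exp _⟩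
  have hcs : c ^ (γ + 1) = P / Q := by
    rw [Real.rpow_def_of_pos hc, hclog, div_mul_cancel₀ _ hs.ne', Real.exp_sub,
      Real.exp_log hpPos, Real.exp_log hqPos]
  let g : X → ℝ := fun x => p x ^ (γ + 1) / (γ + 1) + (c ^ (γ + 1) * γ / (γ + 1)) * q x ^ (γ + 1)
    - c ^ γ * (p x * q x ^ γ)
  have hgx : ∀ x, 0 ≤ g x ∧ (g x = 0 → p x = c * q x) := by
    intro x
    obtain ⟨y1, y2⟩ := young (p x) (c * q x) (hp0 x) (mul_nonneg hc.le (hq0 x))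
    rw [Real.mul_rpow hc.le (hq0 x), Real.mul_rpow hc.le (hq0 x)] at y1 y2
    have e : g x = p x ^ (γ + 1) / (γ + 1) + c ^ (γ + 1) * q x ^ (γ + 1) * γ / (γ + 1)
        - p x * (c ^ γ * q x ^ γ) := by
      simp only [g]
      ring
    rw [e]
    exact ⟨by linarith, fun h => y2 (by linarith)⟩
  have i1 : Integrable (fun x => p x ^ (γ + 1) / (γ + 1)) μ := hpPow.div_const _
  have i2 : Integrable (fun x => (c ^ (γ + 1) * γ / (γ + 1)) * q x ^ (γ + 1)) μ :=
    hqPow.const_mul _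
  have i3 : Integrable (fun x => c ^ γ * (p x * q x ^ γ)) μ := hpq.const_mul _
  have i12 : Integrable (fun x => p x ^ (γ + 1) / (γ + 1)
    + (c ^ (γ + 1) * γ / (γ + 1)) * q x ^ (γ + 1)) μ := i1.add i2
  have hgi : Integrable g μ := i12.sub i3
  have hgint : ∫ x, g x ∂μ = P - c ^ γ * I := by
    simp only [g]
    rw [integral_sub i12 i3, integral_add i1 i2, integral_div, integral_const_mul,
      integral_const_mul, ← hP, ← hQ, ← hI, hcs]
    field_simp
    ring
  have hg0 : 0 ≤ ∫ x, g x ∂μ := integral_nonneg fun x => (hgx x).1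
  have hcI : 0 < c ^ γ * I := mul_pos (Real.rpow_pos_of_pos hc γ) hpqPos
  have hlog : Real.log (c ^ γ * I) = γ * ((Real.log P - Real.log Q) / (γ + 1)) + Real.log I := by
    rw [Real.log_mul (Real.rpow_pos_of_pos hc γ).ne' hpqPos.ne', Real.log_rpow hc, hclog]
  have hD : -(1 / γ) * Real.log I + (1 / (γ + 1)) * Real.log Q
      + (1 / (γ * (γ + 1))) * Real.log P = (Real.log P - Real.log (c ^ γ * I)) / γ := by
    rw [hlog]
    field_simp
    ring
  rw [hD]
  refine ⟨div_nonneg (sub_nonneg.2 (Real.log_le_log hcI (by linarith))) hγ.le, ?_, ?_⟩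
  · intro h
    have h1 : Real.log P = Real.log (c ^ γ * I) := by
      rcases div_eq_zero_iff.1 h with h | h
      · linarith
      · exact absurd h hγ.ne'
    have h2 : P = c ^ γ * I := Real.log_injOn_pos hpPos hcI h1
    have h3 : ∫ x, g x ∂μ = 0 := by rw [hgint]; linarith
    have h4 : g =ᵐ[μ] 0 := (integral_eq_zero_iff_of_nonneg (fun x => (hgx x).1) hgi).1 h3
    have h5 : p =ᵐ[μ] fun x => c * q x := by
      filter_upwards [h4] with x hx
      exact (hgx x).2 hx
    have h6 : c = 1 := by
      have := integral_congr_ae h5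
      rw [integral_const_mul, hp1, hq1] at this
      linarith
    simpa [h6] using h5
  · intro h
    have hPQ : P = Q := by
      apply integral_congr_ae
      filter_upwards [h] with x hx
      rw [hx]
    have hIQ : I = Q := by
      apply integral_congr_ae
      filter_upwards [h] with x hx
      rw [hx, add_comm γ 1, Real.rpow_add' (hq0 x) (by linarith), Real.rpow_one]
    rw [hlog, hPQ, hIQ]
    simp
end

section
/- Let μ be a finite measure on X, p a probability density with respect to μ, γ > 0, and E : ℝ^d × X → ℝ, written (θ, x) ↦ E_θ(x), a function such that for each x, θ ↦ E_θ(x) is continuously differentiable, and such that |E_θ(x)| ≤ K and ‖∇_θ E_θ(x)‖ ≤ L for all θ, x (with constants K, L > 0), with E and ∇_θ E jointly measurable. Define the loss 𝓛_γ(θ) = −(1/γ)·log(∫ p(x) e^{−γ E_θ(x)} dμ(x)) + (1/(γ+1))·log(∫ e^{−(γ+1) E_θ(x)} dμ(x)). Then 𝓛_γ is differentiable in θ and its gradient equals ∇_θ 𝓛_γ(θ) = (∫ p(x) e^{−γ E_θ(x)} ∇_θ E_θ(x) dμ(x)) / (∫ p(x) e^{−γ E_θ(x)} dμ(x)) − (∫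 e^{−(γ+1) E_θ(x)} ∇_θ E_θ(x) dμ(x)) / (∫ e^{−(γ+1) E_θ(x)} dμ(x)); that is, ∇_θ 𝓛_γ(θ) = −(1/γ)·∇_θ log E_p[e^{−γ E_θ}] − E_{r_θ}[∇_θ E_θ], where r_θ is the probability density proportional to e^{−(γ+1) E_θ}. -/
open MeasureTheory

theorem ps_cd_aux
    {X : Type*} [MeasurableSpace X] (μ : Measure X)
    {d : ℕ} (c K L : ℝ) (hc : 0 < c) (hL : 0 < L)
    (p : X → ℝ) (hp : Measurable p) (hp0 : ∀ x, 0 ≤ p x) (hpi : Integrable p μ)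
    (hp1 : 0 < ∫ x, p x ∂μ)
    (E : EuclideanSpace ℝ (Fin d) → X → ℝ)
    (E' : EuclideanSpace ℝ (Fin d) → X → EuclideanSpace ℝ (Fin d))
    (hE : ∀ (x : X) (θ : EuclideanSpace ℝ (Fin d)),
      HasGradientAt (fun θ' => E θ' x) (E' θ x) θ)
    (hEbound : ∀ θ x, |E θ x| ≤ K)
    (hE'bound : ∀ θ x, ‖E' θ x‖ ≤ L)
    (hEm : ∀ θ, Measurable (E θ)) (hE'm : ∀ θ, Measurable (E' θ))
    (θ : EuclideanSpace ℝ (Fin d)) :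
    HasFDerivAt (fun θ' => Real.log (∫ x, p x * Real.exp (-c * E θ' x) ∂μ))
      (innerSL ℝ (-c • ((∫ x, p x * Real.exp (-c * E θ x) ∂μ)⁻¹ •
            (∫ x, (p x * Real.exp (-c * E θ x)) • E' θ x ∂μ)))) θ := by
  have hexp : ∀ θ x, Real.exp (-c * E θ x) ≤ Real.exp (c * K) := by
    intro θ x
    apply Real.exp_le_exp.2
    have := (abs_le.1 (hEbound θ x)).1
    nlinarith
  have hexp' : ∀ θ x, Real.exp (-c * K) ≤ Real.exp (-c * E θ x) := by
    intro θ x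
    apply Real.exp_le_exp.2
    have := (abs_le.1 (hEbound θ x)).2
    nlinarith
  have hm : ∀ θ, Measurable (fun x => p x * Real.exp (-c * E θ x)) := fun θ =>
    hp.mul (((hEm θ).const_mul (-c)).exp)
  have hint : ∀ θ, Integrable (fun x => p x * Real.exp (-c * E θ x)) μ := by
    intro θ
    refine (hpi.mul_const (Real.exp (c * K))).mono' (hm θ).aestronglyMeasurable ?_
    refine Filter.Eventually.of_forall fun x => ?_
    rw [Real.norm_of_nonneg (mul_nonneg (hp0 x) (Real.exp_pos _).le)]
    exact mul_le_mul_of_nonneg_left (hexp θ x) (hp0 x)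
  have hpos : 0 < ∫ x, p x * Real.exp (-c * E θ x) ∂μ := by
    have h1 : ∫ x, p x * Real.exp (-c * K) ∂μ ≤ ∫ x, p x * Real.exp (-c * E θ x) ∂μ :=
      integral_mono (hpi.mul_const _) (hint θ)
        (fun x => mul_le_mul_of_nonneg_left (hexp' θ x) (hp0 x))
    rw [integral_mul_const] at h1
    exact lt_of_lt_of_le (mul_pos hp1 (Real.exp_pos _)) h1
  have hvm : ∀ θ, Measurable (fun x => (p x * Real.exp (-c * E θ x)) • E' θ x) := fun θ =>
    (hm θ).smul (hE'm θ)
  have hvb : ∀ θ x, ‖(p x * Real.exp (-c * E θ x)) • E' θ x‖ ≤ p x * (Real.exp (c * K) * L) := by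
    intro θ x
    rw [norm_smul, Real.norm_of_nonneg (mul_nonneg (hp0 x) (Real.exp_pos _).le), mul_assoc]
    exact mul_le_mul_of_nonneg_left (mul_le_mul (hexp θ x) (hE'bound θ x) (norm_nonneg _)
      (Real.exp_pos _).le) (hp0 x)
  have hvi : Integrable (fun x => (p x * Real.exp (-c * E θ x)) • E' θ x) μ :=
    (hpi.mul_const _).mono' (hvm θ).aestronglyMeasurable (Filter.Eventually.of_forall (hvb θ))
  have hd : ∀ x θ, HasFDerivAt (fun θ' => p x * Real.exp (-c * E θ' x))
      (innerSL ℝ (-c • ((p x * Real.exp (-c * E θ x)) • E' θ x))) θ := by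
    intro x θ
    have h0 : HasFDerivAt (fun θ' => E θ' x) (innerSL ℝ (E' θ x)) θ := (hE x θ).hasFDerivAt
    refine (((h0.const_mul (-c)).exp).const_mul (p x)).congr_fderiv ?_
    simp only [map_smul, smul_smul]
    congr 1
    ring
  have key := hasFDerivAt_integral_of_dominated_of_fderiv_le (𝕜 := ℝ) (μ := μ)
    (F := fun θ x => p x * Real.exp (-c * E θ x))
    (F' := fun θ x => innerSL ℝ (-c • ((p x * Real.exp (-c * E θ x)) • E' θ x)))
    (bound := fun x => c * (p x * (Real.exp (c * K) * L))) (x₀ := θ) (s := Set.univ)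
    Filter.univ_mem (Filter.Eventually.of_forall fun θ => (hm θ).aestronglyMeasurable) (hint θ)
    ((innerSL ℝ).continuous.comp_aestronglyMeasurable
      ((hvm θ).const_smul (-c)).aestronglyMeasurable)
    (Filter.Eventually.of_forall fun x θ _ => by
      rw [innerSL_apply_norm, norm_smul, norm_neg, Real.norm_of_nonneg hc.le]
      exact mul_le_mul_of_nonneg_left (hvb θ x) hc.le)
    ((hpi.mul_const _).const_mul c)
    (Filter.Eventually.of_forall fun x θ _ => hd x θ)
  refine (key.log hpos.ne').congr_fderiv ?_
  have hcomm : ∫ x, innerSL ℝ (-c • ((p x * Real.exp (-c * E θ x)) • E' θ x)) ∂μ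
      = innerSL ℝ (∫ x, -c • ((p x * Real.exp (-c * E θ x)) • E' θ x) ∂μ) :=
    ContinuousLinearMap.integral_comp_comm (innerSL ℝ) (hvi.smul (-c))
  rw [hcomm, integral_smul, smul_comm (-c) _ _]
  simp only [map_smul]

/-- Theorem 2 (PS-CD gradient): the negative γ-score
`𝓛_γ(θ) = −(1/γ) log ∫ p e^{−γE_θ} dμ + (1/(γ+1)) log ∫ e^{−(γ+1)E_θ} dμ`
is differentiable in `θ`, with gradient
`(∫ p e^{−γE_θ} ∇E_θ dμ)/(∫ p e^{−γE_θ} dμ) − (∫ e^{−(γ+1)E_θ} ∇E_θ dμ)/(∫ e^{−(γ+1)E_θ} dμ)`,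
i.e. `−(1/γ)∇ log E_p[e^{−γE_θ}] − E_{r_θ}[∇E_θ]` where `r_θ ∝ e^{−(γ+1)E_θ}`. -/
theorem ps_cd_gradient
    {X : Type*} [MeasurableSpace X] (μ : Measure X) [IsFiniteMeasure μ]
    {d : ℕ} (γ K L : ℝ) (hγ : 0 < γ) (hK : 0 < K) (hL : 0 < L)
    (p : X → ℝ) (hp : Measurable p) (hp0 : ∀ x, 0 ≤ p x) (hp1 : ∫ x, p x ∂μ = 1)
    (E : EuclideanSpace ℝ (Fin d) → X → ℝ)
    (E' : EuclideanSpace ℝ (Fin d) → X → EuclideanSpace ℝ (Fin d))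
    (hE : ∀ (x : X) (θ : EuclideanSpace ℝ (Fin d)),
      HasGradientAt (fun θ' => E θ' x) (E' θ x) θ)
    (hE'cont : ∀ x : X, Continuous fun θ => E' θ x)
    (hEbound : ∀ θ x, |E θ x| ≤ K)
    (hE'bound : ∀ θ x, ‖E' θ x‖ ≤ L)
    (hEmeas : Measurable fun px : EuclideanSpace ℝ (Fin d) × X => E px.1 px.2)
    (hE'meas : Measurable fun px : EuclideanSpace ℝ (Fin d) × X => E' px.1 px.2) :
    ∀ θ : EuclideanSpace ℝ (Fin d),
      HasGradientAt
        (fun θ' => -(1 / γ) * Real.log (∫ x, p x * Real.exp (-γ * E θ' x) ∂μ)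
          + (1 / (γ + 1)) * Real.log (∫ x, Real.exp (-(γ + 1) * E θ' x) ∂μ))
        ((∫ x, p x * Real.exp (-γ * E θ x) ∂μ)⁻¹ •
            (∫ x, (p x * Real.exp (-γ * E θ x)) • E' θ x ∂μ)
          - (∫ x, Real.exp (-(γ + 1) * E θ x) ∂μ)⁻¹ •
            (∫ x, Real.exp (-(γ + 1) * E θ x) • E' θ x ∂μ))
        θ := by
  intro θ
  have hpi : Integrable p μ := by
    by_contra h
    rw [integral_undef h] at hp1
    exact zero_ne_one hp1
  have hμ : μ ≠ 0 := by
    rintro rfl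
    simp at hp1
  have : NeZero μ := ⟨hμ⟩
  have hEm : ∀ θ, Measurable (E θ) := fun θ => hEmeas.comp measurable_prodMk_left
  have hE'm : ∀ θ, Measurable (E' θ) := fun θ => hE'meas.comp measurable_prodMk_left
  have h1 := ps_cd_aux μ γ K L hγ hL p hp hp0 hpi (by rw [hp1]; exact one_pos) E E' hE hEbound
    hE'bound hEm hE'm θ
  have h2 := ps_cd_aux μ (γ + 1) K L (by linarith) hL (fun _ => 1) measurable_const
    (fun _ => zero_le_one) (integrable_const _)
    (by simpa using measureReal_univ_pos) E E' hE hEbound hE'bound hEm hE'm θ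
  simp only [one_mul] at h2
  have hγ1 : γ + 1 ≠ 0 := by linarith
  rw [hasGradientAt_iff_hasFDerivAt]
  refine ((h1.const_mul (-(1 / γ))).add (h2.const_mul (1 / (γ + 1)))).congr_fderiv ?_
  change _ = innerSL ℝ _
  rw [← map_smul, ← map_smul, ← map_add]
  congr 1
  rw [smul_smul (-(1 / γ)) (-γ), smul_smul (1 / (γ + 1)) (-(γ + 1)),
    show -(1 / γ) * -γ = 1 by field_simp,
    show 1 / (γ + 1) * -(γ + 1) = -1 by field_simp, one_smul, neg_one_smul, sub_eq_add_neg]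
end

section
/- Let p and q be probability densities with respect to μ whose values lie in an interval [a, b] with 0 < a ≤ b < ∞. Then the γ-divergence D_γ(p, q) = −(1/γ)·log(∫ p q^γ dμ) + (1/(γ+1))·log(∫ q^{γ+1} dμ) + (1/(γ(γ+1)))·log(∫ p^{γ+1} dμ) converges, as γ → 0⁺, to the Kullback–Leibler divergence D_KL(p‖q) = ∫ p · log(p/q) dμ. -/
open MeasureTheory Filter

lemma gamma_aux {X : Type*} [MeasurableSpace X] (μ : Measure X) [IsFiniteMeasure μ]
    (a b : ℝ) (ha : 0 < a)
    (f g : X → ℝ) (hf : Measurable f) (hg : Measurable g)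
    (hfm : ∀ x, f x ∈ Set.Icc a b) (hgm : ∀ x, g x ∈ Set.Icc a b)
    (hf1 : ∫ x, f x ∂μ = 1) :
    Integrable (fun x => f x * Real.log (g x)) μ ∧
    Tendsto (fun γ : ℝ => ∫ x, f x * g x ^ γ ∂μ) (nhdsWithin 0 (Set.Ioi 0)) (nhds 1) ∧
    Tendsto (fun γ : ℝ => γ⁻¹ * Real.log (∫ x, f x * g x ^ γ ∂μ))
      (nhdsWithin 0 (Set.Ioi 0)) (nhds (∫ x, f x * Real.log (g x) ∂μ)) := by
  have hgpos : ∀ x, 0 < g x := fun x => ha.trans_le (hgm x).1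
  have hint : Integrable f μ := by
    by_contra h
    rw [integral_undef h] at hf1
    exact zero_ne_one hf1
  set C : ℝ := max |Real.log a| |Real.log b| with hC
  have hlog : ∀ x, |Real.log (g x)| ≤ C := fun x =>
    abs_le_max_abs_abs (Real.log_le_log ha (hgm x).1) (Real.log_le_log (hgpos x) (hgm x).2)
  have hC0 : 0 ≤ C := (abs_nonneg _).trans (le_max_left _ _)
  have key := hasDerivAt_integral_of_dominated_loc_of_deriv_le (μ := μ) (𝕜 := ℝ)
    (F := fun γ x => f x * g x ^ γ) (x₀ := (0:ℝ)) (s := Metric.ball 0 1)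
    (F' := fun γ x => f x * (g x ^ γ * Real.log (g x)))
    (bound := fun _ => b * (Real.exp C * C))
    (Metric.ball_mem_nhds _ one_pos)
    (Eventually.of_forall fun γ => by
      exact (hf.mul (hg.pow_const γ)).aestronglyMeasurable)
    (by simpa using hint)
    (by exact (hf.mul ((hg.pow_const 0).mul hg.log)).aestronglyMeasurable)
    (Eventually.of_forall fun x γ hγ => by
      have hγ1 : |γ| ≤ 1 := by
        have := Metric.mem_ball.1 hγ
        rw [Real.dist_eq, sub_zero] at this
        exact this.le
      have h1 : g x ^ γ ≤ Real.exp C := by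
        rw [Real.rpow_def_of_pos (hgpos x)]
        apply Real.exp_le_exp.2
        calc Real.log (g x) * γ ≤ |Real.log (g x) * γ| := le_abs_self _
          _ = |Real.log (g x)| * |γ| := abs_mul _ _
          _ ≤ C * 1 := mul_le_mul (hlog x) hγ1 (abs_nonneg _) hC0
          _ = C := mul_one _
      have hf0 : 0 ≤ f x := ha.le.trans (hfm x).1
      have hr : 0 ≤ g x ^ γ := (Real.rpow_pos_of_pos (hgpos x) γ).le
      rw [Real.norm_eq_abs, abs_mul, abs_mul, abs_of_nonneg hf0, abs_of_nonneg hr]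
      have hb0 : 0 ≤ b := hf0.trans (hfm x).2
      exact mul_le_mul (hfm x).2 (mul_le_mul h1 (hlog x) (abs_nonneg _) (Real.exp_pos _).le)
        (by positivity) hb0)
    (integrable_const _)
    (Eventually.of_forall fun x γ _ => by
      exact (Real.hasStrictDerivAt_const_rpow (hgpos x) γ).hasDerivAt.const_mul (f x))
  obtain ⟨hI, hD⟩ := key
  simp only [Real.rpow_zero, one_mul] at hI hD
  have hv : ∫ x, f x * g x ^ (0:ℝ) ∂μ = 1 := by simpa using hf1
  refine ⟨hI, ?_, ?_⟩
  · have := hD.continuousAt.tendsto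
    rw [hv] at this
    exact this.mono_left nhdsWithin_le_nhds
  · have h := (hD.log (by rw [hv]; exact one_ne_zero)).tendsto_slope_zero_right
    simpa [hf1] using h

/-- As `γ → 0⁺`, the γ-divergence `D_γ(p,q)` converges to the Kullback–Leibler
divergence `D_KL(p‖q) = ∫ p log(p/q)`. -/
theorem gamma_divergence_tendsto_KL
    {X : Type*} [MeasurableSpace X] (μ : Measure X) [IsFiniteMeasure μ]
    (a b : ℝ) (ha : 0 < a) (hab : a ≤ b)
    (p q : X → ℝ) (hp : Measurable p) (hq : Measurable q)
    (hpmem : ∀ x, p x ∈ Set.Icc a b) (hqmem : ∀ x, q x ∈ Set.Icc a b)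
    (hp1 : ∫ x, p x ∂μ = 1) (hq1 : ∫ x, q x ∂μ = 1) :
    Tendsto (fun γ : ℝ =>
        -(1 / γ) * Real.log (∫ x, p x * q x ^ γ ∂μ)
          + (1 / (γ + 1)) * Real.log (∫ x, q x ^ (γ + 1) ∂μ)
          + (1 / (γ * (γ + 1))) * Real.log (∫ x, p x ^ (γ + 1) ∂μ))
      (nhdsWithin 0 (Set.Ioi 0))
      (nhds (∫ x, p x * Real.log (p x / q x) ∂μ)) := by
  obtain ⟨hIq, -, h1⟩ := gamma_aux μ a b ha p q hp hq hpmem hqmem hp1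
  obtain ⟨hIp, -, h2⟩ := gamma_aux μ a b ha p p hp hp hpmem hpmem hp1
  obtain ⟨-, h3, -⟩ := gamma_aux μ a b ha q q hq hq hqmem hqmem hq1
  have hppos : ∀ x, 0 < p x := fun x => ha.trans_le (hpmem x).1
  have hqpos : ∀ x, 0 < q x := fun x => ha.trans_le (hqmem x).1
  have ep : ∀ (γ : ℝ) x, p x ^ (γ + 1) = p x * p x ^ γ := fun γ x => by
    rw [Real.rpow_add_one (hppos x).ne', mul_comm]
  have eq' : ∀ (γ : ℝ) x, q x ^ (γ + 1) = q x * q x ^ γ := fun γ x => by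
    rw [Real.rpow_add_one (hqpos x).ne', mul_comm]
  have e : ∫ x, p x * Real.log (p x / q x) ∂μ
      = -(∫ x, p x * Real.log (q x) ∂μ) + 1 * Real.log 1
        + 1 * ∫ x, p x * Real.log (p x) ∂μ := by
    have : ∀ x, p x * Real.log (p x / q x)
        = p x * Real.log (p x) - p x * Real.log (q x) := fun x => by
      rw [Real.log_div (hppos x).ne' (hqpos x).ne', mul_sub]
    simp only [this]
    rw [integral_sub hIp hIq, Real.log_one]
    ring
  have h4 : Tendsto (fun γ : ℝ => 1 / (γ + 1)) (nhdsWithin 0 (Set.Ioi 0)) (nhds 1) := by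
    have : ContinuousAt (fun γ : ℝ => 1 / (γ + 1)) 0 :=
      ContinuousAt.div (by fun_prop) (by fun_prop) (by norm_num)
    have h := this.tendsto
    simp only [zero_add, div_one] at h
    exact h.mono_left nhdsWithin_le_nhds
  rw [e]
  simp only [ep, eq']
  refine ((h1.neg.add (h4.mul (h3.log one_ne_zero))).add (h4.mul h2)).congr fun γ => ?_
  simp only [one_div, mul_inv]
  ring
end

section
/- Let μ be a finite measure on X, p a probability density with respect to μ, E : X → ℝ measurable and bounded, and h : X → ℝ^d measurable and bounded. Then the PS-CD gradient expression converges to the contrastive-divergence (maximum likelihood) gradient expression as γ → 0⁺: lim_{γ→0⁺} [ (∫ p e^{−γE} h dμ)/(∫ p e^{−γE} dμ) − (∫ e^{−(γ+1)E} h dμ)/(∫ e^{−(γ+1)E} dμ) ] = ∫ p h dμ − (∫ e^{−E} h dμ)/(∫ e^{−E} dμ). -/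
open MeasureTheory Filter

/-- Dominated convergence for the tilted integrals. -/
theorem tilted_tendsto_aux {X F : Type*} [MeasurableSpace X] (μ : Measure X)
    [NormedAddCommGroup F] [NormedSpace ℝ F]
    (q : X → ℝ) (hq0 : ∀ x, 0 ≤ q x) (hqi : Integrable q μ)
    (E : X → ℝ) (hE : Measurable E) (K : ℝ) (hEb : ∀ x, |E x| ≤ K)
    (g : X → F) (hg : AEStronglyMeasurable g μ) (L : ℝ) (hgb : ∀ x, ‖g x‖ ≤ L) :
    Tendsto (fun γ : ℝ => ∫ x, (q x * Real.exp (-γ * E x)) • g x ∂μ)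
      (nhdsWithin 0 (Set.Ioi 0)) (nhds (∫ x, q x • g x ∂μ)) := by
  refine tendsto_integral_filter_of_dominated_convergence
    (fun x => q x * (Real.exp K * L)) ?_ ?_ ?_ ?_
  · refine Eventually.of_forall fun γ => ?_
    have hm : Measurable fun x => Real.exp (-γ * E x) := by fun_prop
    exact (hqi.aestronglyMeasurable.mul hm.aestronglyMeasurable).smul hg
  · filter_upwards [Ioo_mem_nhdsGT (show (0 : ℝ) < 1 by norm_num)] with γ hγ
    refine Eventually.of_forall fun x => ?_
    have h1 : -γ * E x ≤ K := by
      have h2 := abs_le.1 (hEb x)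
      have h3 : |γ * E x| ≤ 1 * K := by
        rw [abs_mul, abs_of_pos hγ.1]
        exact mul_le_mul hγ.2.le (hEb x) (abs_nonneg _) zero_le_one
      have h4 := (abs_le.1 h3).1
      linarith
    rw [norm_smul, Real.norm_of_nonneg (mul_nonneg (hq0 x) (Real.exp_pos _).le), mul_assoc]
    exact mul_le_mul_of_nonneg_left
      (mul_le_mul (Real.exp_le_exp.2 h1) (hgb x) (norm_nonneg _) (Real.exp_pos _).le) (hq0 x)
  · exact hqi.mul_const _
  · refine Eventually.of_forall fun x => ?_
    have hc : Continuous fun γ : ℝ => (q x * Real.exp (-γ * E x)) • g x := by fun_prop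
    have := (hc.tendsto 0).mono_left (nhdsWithin_le_nhds (s := Set.Ioi 0))
    simpa using this

/-- As `γ → 0⁺`, the PS-CD gradient expression converges to the
contrastive-divergence (maximum likelihood) gradient expression. -/
theorem ps_cd_gradient_tendsto_cd_gradient
    {X : Type*} [MeasurableSpace X] (μ : Measure X) [IsFiniteMeasure μ]
    {d : ℕ}
    (p : X → ℝ) (hp : Measurable p) (hp0 : ∀ x, 0 ≤ p x) (hp1 : ∫ x, p x ∂μ = 1)
    (E : X → ℝ) (hE : Measurable E) (K : ℝ) (hEb : ∀ x, |E x| ≤ K)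
    (h : X → EuclideanSpace ℝ (Fin d)) (hh : Measurable h)
    (L : ℝ) (hhb : ∀ x, ‖h x‖ ≤ L) :
    Tendsto (fun γ : ℝ =>
        (∫ x, p x * Real.exp (-γ * E x) ∂μ)⁻¹ •
            (∫ x, (p x * Real.exp (-γ * E x)) • h x ∂μ)
          - (∫ x, Real.exp (-(γ + 1) * E x) ∂μ)⁻¹ •
            (∫ x, Real.exp (-(γ + 1) * E x) • h x ∂μ))
      (nhdsWithin 0 (Set.Ioi 0))
      (nhds ((∫ x, p x • h x ∂μ)
        - (∫ x, Real.exp (-E x) ∂μ)⁻¹ • (∫ x, Real.exp (-E x) • h x ∂μ))) := by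
  have hpi : Integrable p μ := by
    by_contra hn
    rw [integral_undef hn] at hp1
    exact zero_ne_one hp1
  have hμ : NeZero μ := ⟨by
    rintro rfl
    simp at hp1⟩
  have hei : Integrable (fun x => Real.exp (-E x)) μ := by
    refine Integrable.of_bound (by fun_prop) (Real.exp K) (Eventually.of_forall fun x => ?_)
    rw [Real.norm_of_nonneg (Real.exp_pos _).le]
    exact Real.exp_le_exp.2 (by linarith [(abs_le.1 (hEb x)).1])
  have he0 : ∀ x, 0 ≤ Real.exp (-E x) := fun x => (Real.exp_pos _).le
  have hh' : AEStronglyMeasurable h μ := hh.aestronglyMeasurable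
  have ho : AEStronglyMeasurable (fun _ : X => (1 : ℝ)) μ := aestronglyMeasurable_const
  have A := tilted_tendsto_aux μ p hp0 hpi E hE K hEb h hh' L hhb
  have B := tilted_tendsto_aux μ p hp0 hpi E hE K hEb (fun _ => (1 : ℝ)) ho 1 (by simp)
  have C := tilted_tendsto_aux μ _ he0 hei E hE K hEb h hh' L hhb
  have D := tilted_tendsto_aux μ _ he0 hei E hE K hEb (fun _ => (1 : ℝ)) ho 1 (by simp)
  simp only [smul_eq_mul, mul_one] at B D
  have hexp : ∀ γ x, Real.exp (-(γ + 1) * E x) = Real.exp (-E x) * Real.exp (-γ * E x) := by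
    intro γ x
    rw [← Real.exp_add]
    congr 1
    ring
  simp only [hexp]
  have hpos : (∫ x, Real.exp (-E x) ∂μ) ≠ 0 := (integral_exp_pos hei).ne'
  rw [hp1] at B
  have R := ((B.inv₀ one_ne_zero).smul A).sub ((D.inv₀ hpos).smul C)
  simpa only [inv_one, one_smul] using R
end

section
/- Let −1 ≤ γ < 0 and let p and q be probability densities with respect to μ with the values of q lying in an interval [a, b], 0 < a ≤ b < ∞. Then the extended γ-score satisfies S_γ(p, q) = (1/γ)·log(∫ p q^γ dμ) − (1/(γ+1))·log(∫ q^{γ+1} dμ) ≤ ∫ p · log q dμ + (γ/(γ+1))·H_{γ+1}(q), where H_{γ+1}(q) = (1/(−γ))·log(∫ q^{γ+1} dμ) is the Rényi entropy of order γ+1. That is, for negative γ the γ-score lower-bounds the expected logarithm score plus a Rényi entropy regularization term. -/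
open MeasureTheory

/-- For `−1 ≤ γ < 0`, the extended γ-score lower-bounds the expected logarithm
score plus a Rényi-entropy regularization term:
`S_γ(p,q) ≤ ∫ p log q + (γ/(γ+1)) H_{γ+1}(q)` where
`H_{γ+1}(q) = (1/(−γ)) log ∫ q^{γ+1}`.  (When `γ = −1` the terms containing
`1/(γ+1)` vanish, matching the stated convention, since division by zero is zero
in Lean.) -/
theorem gamma_score_neg_gamma_le_log_score_plus_renyi
    {X : Type*} [MeasurableSpace X] (μ : Measure X) [IsFiniteMeasure μ]
    (γ : ℝ) (hγ1 : -1 ≤ γ) (hγ2 : γ < 0)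
    (a b : ℝ) (ha : 0 < a) (hab : a ≤ b)
    (p q : X → ℝ) (hp : Measurable p) (hq : Measurable q)
    (hp0 : ∀ x, 0 ≤ p x) (hp1 : ∫ x, p x ∂μ = 1)
    (hqmem : ∀ x, q x ∈ Set.Icc a b) (hq1 : ∫ x, q x ∂μ = 1) :
    (1 / γ) * Real.log (∫ x, p x * q x ^ γ ∂μ)
        - (1 / (γ + 1)) * Real.log (∫ x, q x ^ (γ + 1) ∂μ)
      ≤ (∫ x, p x * Real.log (q x) ∂μ)
        + (γ / (γ + 1)) * ((1 / (-γ)) * Real.log (∫ x, q x ^ (γ + 1) ∂μ)) := by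
  have hq0 : ∀ x, 0 < q x := fun x => lt_of_lt_of_le ha (hqmem x).1
  have hpi : Integrable p μ := by
    by_contra h
    rw [integral_undef h] at hp1
    exact zero_ne_one hp1
  have hlog : Integrable (fun x => p x * Real.log (q x)) μ := by
    refine hpi.mul_bdd (c := max |Real.log a| |Real.log b|)
      (Real.measurable_log.comp hq).aestronglyMeasurable (Filter.Eventually.of_forall fun x => ?_)
    exact abs_le_max_abs_abs (Real.log_le_log ha (hqmem x).1)
      (Real.log_le_log (hq0 x) (hqmem x).2)
  have hpow : Integrable (fun x => p x * q x ^ γ) μ := by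
    refine hpi.mul_bdd (c := a ^ γ)
      (hq.pow_const γ).aestronglyMeasurable (Filter.Eventually.of_forall fun x => ?_)
    rw [Real.norm_of_nonneg (Real.rpow_nonneg (hq0 x).le γ)]
    exact Real.rpow_le_rpow_of_nonpos ha (hqmem x).1 hγ2.le
  set J := ∫ x, p x * Real.log (q x) ∂μ with hJ
  have key : Real.exp (γ * J) ≤ ∫ x, p x * q x ^ γ ∂μ := by
    have hint : Integrable (fun x => Real.exp (γ * J) * ((1 - γ * J) * p x
        + γ * (p x * Real.log (q x)))) μ :=
      ((hpi.const_mul (1 - γ * J)).add (hlog.const_mul γ)).const_mul _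
    have hval : ∫ x, Real.exp (γ * J) * ((1 - γ * J) * p x
        + γ * (p x * Real.log (q x))) ∂μ = Real.exp (γ * J) := by
      rw [integral_const_mul, integral_add (hpi.const_mul (1 - γ * J)) (hlog.const_mul γ),
        integral_const_mul, integral_const_mul, hp1, ← hJ]
      ring
    rw [← hval]
    refine integral_mono hint hpow fun x => ?_
    have h1 : q x ^ γ = Real.exp (γ * J) * Real.exp (γ * Real.log (q x) - γ * J) := by
      rw [Real.rpow_def_of_pos (hq0 x), ← Real.exp_add]
      congr 1
      ring
    have h2 := Real.add_one_le_exp (γ * Real.log (q x) - γ * J)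
    have h3 := mul_le_mul_of_nonneg_left h2
      (mul_nonneg (hp0 x) (Real.exp_pos (γ * J)).le)
    simp only [h1]
    nlinarith [h3]
  have hlogI := (Real.le_log_iff_exp_le (lt_of_lt_of_le (Real.exp_pos _) key)).2 key
  have hmain : 1 / γ * Real.log (∫ x, p x * q x ^ γ ∂μ) ≤ J := by
    rw [one_div_mul_eq_div, div_le_iff_of_neg hγ2]
    linarith
  have hren : γ / (γ + 1) * (1 / (-γ) * Real.log (∫ x, q x ^ (γ + 1) ∂μ))
      = - (1 / (γ + 1) * Real.log (∫ x, q x ^ (γ + 1) ∂μ)) := by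
    have h : γ * (1 / (-γ)) = -1 := by
      have := hγ2.ne
      field_simp
    linear_combination (1 / (γ + 1) * Real.log (∫ x, q x ^ (γ + 1) ∂μ)) * h
  rw [hren]
  linarith
end

section
/- (Convergence of randomized SGD with relatively accurate biased gradients.) Let 𝓛 : ℝ^d → ℝ be differentiable with M-Lipschitz gradient (M > 0) and bounded below with infimum 𝓛*. Fix α ∈ (0, 1), γ > 0, K > 0, L > 0, and T ∈ ℕ. Let θ_1, …, θ_{T+1} and ĝ_1, …, ĝ_T satisfy θ_{t+1} = θ_t − η_t ĝ_t, where the step sizes satisfy 0 < η_t < 2(1−α)/M, and assume for every t = 1, …, T that ‖ĝ_t − ∇𝓛(θ_t)‖ ≤ α‖∇𝓛(θ_t)‖ and ‖∇𝓛(θ_t)‖ ≤ 2 L e^{2γK}. Then, with weights p_Z(t) = (2(1−α)η_t − M η_t²) / Σ_{s=1}^T (2(1−α)η_s − M η_s²), the weighted average of squared gradient norms satisfies Σ_{t=1}^T p_Z(t) ‖∇𝓛(θ_t)‖² < ( 2(𝓛(θ_1) − 𝓛*) + 12 α M L² e^{4γK} Σ_{t=1}^T η_t² ) / Σ_{t=1}^T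 (2(1−α)η_t − M η_t²). -/
open MeasureTheory

theorem descent_aux {d : ℕ} (M : ℝ)
    (f : EuclideanSpace ℝ (Fin d) → ℝ)
    (f' : EuclideanSpace ℝ (Fin d) → EuclideanSpace ℝ (Fin d))
    (hgrad : ∀ x, HasGradientAt f (f' x) x)
    (hsmooth : ∀ x y, ‖f' x - f' y‖ ≤ M * ‖x - y‖)
    (x v : EuclideanSpace ℝ (Fin d)) :
    f (x + v) ≤ f x + inner ℝ (f' x) v + M / 2 * ‖v‖ ^ 2 := by
  have hd : ∀ s : ℝ, HasDerivAt
      (fun s : ℝ => f (x + s • v) - s * inner ℝ (f' x) v - M / 2 * ‖v‖ ^ 2 * s ^ 2)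
      (inner ℝ (f' (x + s • v)) v - inner ℝ (f' x) v - M * ‖v‖ ^ 2 * s) s := by
    intro s
    have h1 : HasDerivAt (fun s : ℝ => x + s • v) v s := by
      simpa using ((hasDerivAt_id s).smul_const v).const_add x
    have h2 := (hgrad (x + s • v)).hasFDerivAt.comp_hasDerivAt s h1
    have h3 : HasDerivAt (fun s : ℝ => s * inner ℝ (f' x) v) (inner ℝ (f' x) v) s := by
      simpa using (hasDerivAt_id s).mul_const (inner ℝ (f' x) v)
    have h4 : HasDerivAt (fun s : ℝ => M / 2 * ‖v‖ ^ 2 * s ^ 2) (M * ‖v‖ ^ 2 * s) s := by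
      have := (hasDerivAt_pow 2 s).const_mul (M / 2 * ‖v‖ ^ 2)
      have e : M / 2 * ‖v‖ ^ 2 * (((2 : ℕ) : ℝ) * s ^ (2 - 1)) = M * ‖v‖ ^ 2 * s := by
        norm_num
        ring
      rw [← e]
      exact this
    have h5 := (h2.sub h3).sub h4
    simp only [InnerProductSpace.toDual_apply_apply] at h5
    exact h5
  have hanti : AntitoneOn
      (fun s : ℝ => f (x + s • v) - s * inner ℝ (f' x) v - M / 2 * ‖v‖ ^ 2 * s ^ 2)
      (Set.Icc 0 1) := by
    apply antitoneOn_of_deriv_nonpos (convex_Icc 0 1)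
    · exact fun s _ => (hd s).continuousAt.continuousWithinAt
    · exact fun s _ => (hd s).differentiableAt.differentiableWithinAt
    · intro s hs
      rw [interior_Icc] at hs
      rw [(hd s).deriv, ← inner_sub_left]
      have h1 := real_inner_le_norm (f' (x + s • v) - f' x) v
      have h2 := hsmooth (x + s • v) x
      rw [add_sub_cancel_left, norm_smul, Real.norm_of_nonneg hs.1.le] at h2
      nlinarith [mul_le_mul_of_nonneg_right h2 (norm_nonneg v)]
  have := hanti (Set.left_mem_Icc.2 zero_le_one) (Set.right_mem_Icc.2 zero_le_one) zero_le_one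
  simp at this
  linarith

/-- Theorem 5 (convergence of randomized SGD with relatively accurate biased
gradients): under `M`-smoothness, step sizes `η_t < 2(1−α)/M`, relative gradient
accuracy `‖ĝ_t − ∇𝓛(θ_t)‖ ≤ α‖∇𝓛(θ_t)‖` and the gradient bound
`‖∇𝓛(θ_t)‖ ≤ 2Le^{2γK}`, the `p_Z`-weighted average of squared gradient norms
satisfies the stated bound. -/
theorem randomized_sgd_biased_gradient_convergence
    {d : ℕ} (M α γ K L : ℝ) (hM : 0 < M) (hα : α ∈ Set.Ioo (0 : ℝ) 1)
    (hγ : 0 < γ) (hK : 0 < K) (hL : 0 < L)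
    (𝓛 : EuclideanSpace ℝ (Fin d) → ℝ)
    (𝓛' : EuclideanSpace ℝ (Fin d) → EuclideanSpace ℝ (Fin d))
    (hgrad : ∀ θ, HasGradientAt 𝓛 (𝓛' θ) θ)
    (hsmooth : ∀ θ₁ θ₂, ‖𝓛' θ₁ - 𝓛' θ₂‖ ≤ M * ‖θ₁ - θ₂‖)
    (Lstar : ℝ) (hLB : ∀ θ, Lstar ≤ 𝓛 θ)
    (T : ℕ) (hT : 1 ≤ T)
    (η : ℕ → ℝ) (hη : ∀ t ∈ Finset.Icc 1 T, 0 < η t ∧ η t < 2 * (1 - α) / M)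
    (θ : ℕ → EuclideanSpace ℝ (Fin d)) (ghat : ℕ → EuclideanSpace ℝ (Fin d))
    (hupd : ∀ t ∈ Finset.Icc 1 T, θ (t + 1) = θ t - η t • ghat t)
    (hacc : ∀ t ∈ Finset.Icc 1 T, ‖ghat t - 𝓛' (θ t)‖ ≤ α * ‖𝓛' (θ t)‖)
    (hgb : ∀ t ∈ Finset.Icc 1 T, ‖𝓛' (θ t)‖ ≤ 2 * L * Real.exp (2 * γ * K)) :
    ∑ t ∈ Finset.Icc 1 T,
        (2 * (1 - α) * η t - M * η t ^ 2)
          / (∑ s ∈ Finset.Icc 1 T, (2 * (1 - α) * η s - M * η s ^ 2))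
          * ‖𝓛' (θ t)‖ ^ 2
      < (2 * (𝓛 (θ 1) - Lstar)
          + 12 * (α * M * L ^ 2 * Real.exp (4 * γ * K)) * ∑ t ∈ Finset.Icc 1 T, η t ^ 2)
        / (∑ t ∈ Finset.Icc 1 T, (2 * (1 - α) * η t - M * η t ^ 2)) := by
  obtain ⟨hα0, hα1⟩ := hα
  have hwpos : ∀ t ∈ Finset.Icc 1 T, 0 < 2 * (1 - α) * η t - M * η t ^ 2 := by
    intro t ht
    obtain ⟨h0, h1⟩ := hη t ht
    rw [lt_div_iff₀ hM] at h1
    nlinarith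
  have hne : (Finset.Icc 1 T).Nonempty := ⟨1, by simp [hT]⟩
  have hS := Finset.sum_pos hwpos hne
  have hstep : ∀ t ∈ Finset.Icc 1 T,
      (2 * (1 - α) * η t - M * η t ^ 2) * ‖𝓛' (θ t)‖ ^ 2
        < 2 * (𝓛 (θ t) - 𝓛 (θ (t + 1)))
          + 12 * (α * M * L ^ 2 * Real.exp (4 * γ * K)) * η t ^ 2 := by
    intro t ht
    have h0 := (hη t ht).1
    have hD := descent_aux M 𝓛 𝓛' hgrad hsmooth (θ t) (-(η t • ghat t))
    rw [← sub_eq_add_neg, ← hupd t ht, inner_neg_right, inner_smul_right, norm_neg, norm_smul,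
      Real.norm_of_nonneg h0.le] at hD
    have ha := hacc t ht
    have hb := hgb t ht
    have hE : Real.exp (4 * γ * K) = Real.exp (2 * γ * K) ^ 2 := by
      rw [← Real.exp_nat_mul]; congr 1; push_cast; ring
    have hEp := Real.exp_pos (2 * γ * K)
    rw [hE]
    generalize Real.exp (2 * γ * K) = E at *
    have hin : (1 - α) * ‖𝓛' (θ t)‖ ^ 2 ≤ inner ℝ (𝓛' (θ t)) (ghat t) := by
      have h1 : inner ℝ (𝓛' (θ t)) (ghat t)
          = ‖𝓛' (θ t)‖ ^ 2 + inner ℝ (𝓛' (θ t)) (ghat t - 𝓛' (θ t)) := by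
        rw [inner_sub_right, real_inner_self_eq_norm_sq]; ring
      have h2 := neg_le_of_abs_le (abs_real_inner_le_norm (𝓛' (θ t)) (ghat t - 𝓛' (θ t)))
      nlinarith [mul_le_mul_of_nonneg_left ha (norm_nonneg (𝓛' (θ t)))]
    have hgn : ‖ghat t‖ ≤ (1 + α) * ‖𝓛' (θ t)‖ := by
      have := norm_le_norm_add_norm_sub' (ghat t) (𝓛' (θ t))
      linarith
    have hG0 := norm_nonneg (𝓛' (θ t))
    have hh0 := norm_nonneg (ghat t)
    generalize ‖𝓛' (θ t)‖ = G at *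
    generalize ‖ghat t‖ = H at *
    have hH2 : H ^ 2 ≤ ((1 + α) * G) ^ 2 := pow_le_pow_left₀ hh0 hgn 2
    have hG2 : G ^ 2 ≤ (2 * L * E) ^ 2 := pow_le_pow_left₀ hG0 hb 2
    have hLE : 0 < (2 * L * E) ^ 2 := by positivity
    have hkey : (2 * α + α ^ 2) * G ^ 2 < 3 * α * (2 * L * E) ^ 2 := by
      have h1 : (2 * α + α ^ 2) * G ^ 2 ≤ (2 * α + α ^ 2) * (2 * L * E) ^ 2 :=
        mul_le_mul_of_nonneg_left hG2 (by positivity)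
      have h2 : (2 * α + α ^ 2) * (2 * L * E) ^ 2 < 3 * α * (2 * L * E) ^ 2 :=
        mul_lt_mul_of_pos_right (by nlinarith) hLE
      linarith
    have hMη : 0 < M * η t ^ 2 := by positivity
    have k1 := mul_lt_mul_of_pos_left hkey hMη
    have k2 := mul_le_mul_of_nonneg_left hH2 hMη.le
    have k3 := mul_le_mul_of_nonneg_left hin h0.le
    nlinarith
  have htel : ∀ n : ℕ, ∑ t ∈ Finset.Icc 1 n, (𝓛 (θ t) - 𝓛 (θ (t + 1)))
      = 𝓛 (θ 1) - 𝓛 (θ (n + 1)) := by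
    intro n
    induction n with
    | zero => simp
    | succ k ih => rw [Finset.sum_Icc_succ_top (by omega), ih]; ring
  have hsum := Finset.sum_lt_sum_of_nonempty hne hstep
  rw [Finset.sum_add_distrib, ← Finset.mul_sum, ← Finset.mul_sum, htel] at hsum
  simp_rw [div_mul_eq_mul_div]
  rw [← Finset.sum_div]
  apply div_lt_div_of_pos_right _ hS
  linarith [hLB (θ (T + 1))]
end
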